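/- arXiv:1612.03771 — 2 statements merged into one kernel-verified Lean document; each statement's English description precedes it below -/
import Mathlib

section
/- Let t be a positive integer, written t = 2t' or t = 2t'+1 according to parity, and let λ be a doubled distinct partition with Littlewood decomposition Ω(λ) = (λ̃, λ^0, λ^1, ..., λ^{t-1}). Then δ_λ = δ_{λ̃} · δ_{λ^0} if t is odd, and δ_λ = δ_{λ̃} · δ_{λ^0} · δ_{λ^{t'}} if t is even. -/
/-!
Statement 11 (Lemma `littlewood` (i)): let `t` be a positive integer (with
`t = 2t'` or `t = 2t'+1` according to parity) and `λ` a doubled distinct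
partition with Littlewood decomposition `Ω(λ) = (λ̃, λ⁰, …, λ^{t-1})`. Then
`δ_λ = δ_{λ̃} · δ_{λ⁰}` if `t` is odd, and `δ_λ = δ_{λ̃} · δ_{λ⁰} · δ_{λ^{t'}}`
if `t` is even.

The Littlewood decomposition is expressed through the standard beta-set
encoding: `λ` is encoded by `S(λ) = {λ_i - i : i ≥ 1} ⊆ ℤ`, the quotient
component `λ^r` by `S_r = {m : t·m + r ∈ S(λ)}`; with `c_r` the charge of `S_r`,
the Durfee length of `λ^r` is `#(S_r ∩ [c_r, ∞))` and that of the `t`-core `λ̃`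
is `Σ_r max(c_r, 0)`.
-/

noncomputable section

/-- The beta-set of a Young diagram: `{λ_{i+1} - (i+1) : i ≥ 0} ⊆ ℤ`. -/
def betaSet (μ : YoungDiagram) : Set ℤ :=
  Set.range fun i : ℕ => (μ.rowLen i : ℤ) - i - 1

/-- The beta-set of the `r`-th component of the `t`-quotient of `μ`. -/
def quotSet (μ : YoungDiagram) (t r : ℕ) : Set ℤ :=
  {m : ℤ | (t : ℤ) * m + r ∈ betaSet μ}

/-- The charge of a subset of `ℤ`. -/
def charge (T : Set ℤ) : ℤ :=
  (Nat.card {m : ℤ // m ∈ T ∧ 0 ≤ m} : ℤ) - (Nat.card {m : ℤ // m ∉ T ∧ m < 0} : ℤ)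

/-- The Durfee length of the partition encoded (up to shift) by `T ⊆ ℤ`. -/
def durfeeOfSet (T : Set ℤ) : ℕ :=
  Nat.card {m : ℤ // m ∈ T ∧ charge T ≤ m}

/-- The Durfee length of the `r`-th component of the `t`-quotient of `μ`. -/
def quotDurfee (μ : YoungDiagram) (t r : ℕ) : ℕ :=
  durfeeOfSet (quotSet μ t r)

/-- The Durfee length of the `t`-core of `μ`. -/
def coreDurfee (μ : YoungDiagram) (t : ℕ) : ℕ :=
  ∑ r ∈ Finset.range t, (charge (quotSet μ t r)).toNat

/-- The Durfee length of a Young diagram: the number of diagonal cells. -/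
def durfee (μ : YoungDiagram) : ℕ :=
  (μ.cells.filter fun c => c.1 = c.2).card

/-- A Young diagram is doubled distinct if, in Frobenius coordinates,
`a_i = b_i + 1` for every diagonal cell. -/
def DDiagram (μ : YoungDiagram) : Prop :=
  ∀ i : ℕ, (i, i) ∈ μ → μ.rowLen i = μ.colLen i + 1

theorem row_lt_iff (μ : YoungDiagram) (i j : ℕ) : j < μ.rowLen i ↔ i < μ.colLen j := by
  rw [← YoungDiagram.mem_iff_lt_rowLen, ← YoungDiagram.mem_iff_lt_colLen]

theorem dd_zero (μ : YoungDiagram) (h : DDiagram μ) : (0 : ℤ) ∉ betaSet μ := by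
  rintro ⟨i, hi⟩
  simp only at hi
  have h1 : i < μ.rowLen i := by omega
  have h2 := h i (YoungDiagram.mem_iff_lt_rowLen.2 h1)
  have h3 := (row_lt_iff μ i i).1 h1
  omega

theorem dd_pos (μ : YoungDiagram) (h : DDiagram μ) (x : ℕ) (hx : 0 < x) :
    (x : ℤ) ∈ betaSet μ ↔ (-x : ℤ) ∉ betaSet μ := by
  constructor
  · rintro ⟨i, hi⟩ ⟨j, hj⟩
    simp only at hi hj
    have h1 : i < μ.rowLen i := by omega
    have h2 := h i (YoungDiagram.mem_iff_lt_rowLen.2 h1)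
    have h3 := row_lt_iff μ j i
    omega
  · intro hn
    have hex : ∃ j, μ.rowLen j + x ≤ j :=
      ⟨μ.rowLen 0 + x, by
        have := μ.rowLen_anti 0 (μ.rowLen 0 + x) (Nat.zero_le _)
        omega⟩
    classical
    obtain ⟨j, hj, hmin⟩ : ∃ j, μ.rowLen j + x ≤ j ∧ ∀ k < j, ¬ (μ.rowLen k + x ≤ k) :=
      ⟨Nat.find hex, Nat.find_spec hex, fun k hk => Nat.find_min hex hk⟩
    have h1 := hmin (j - 1) (by omega)
    have h2 : μ.rowLen (j - 1) + x ≠ j := by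
      intro he
      apply hn
      refine ⟨j - 1, ?_⟩
      simp only
      omega
    have h3 := row_lt_iff μ j (j - x)
    have h4 := row_lt_iff μ (j - 1) (j - x)
    have h5 : μ.colLen (j - x) = j := by omega
    have h6 := h (j - x) (YoungDiagram.mem_iff_lt_colLen.2 (by omega))
    refine ⟨j - x, ?_⟩
    simp only
    omega

theorem dd_symm (μ : YoungDiagram) (h : DDiagram μ) (x : ℤ) (hx : x ≠ 0) :
    -x ∈ betaSet μ ↔ x ∉ betaSet μ := by
  rcases lt_or_gt_of_ne hx with h1 | h1
  · have := dd_pos μ h x.natAbs (by omega)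
    rw [show ((x.natAbs : ℕ) : ℤ) = -x by omega, neg_neg] at this
    exact this
  · have := dd_pos μ h x.natAbs (by omega)
    rw [show ((x.natAbs : ℕ) : ℤ) = x by omega] at this
    tauto

/-- Number of nonnegative elements. -/
def pcard (T : Set ℤ) : ℕ := Nat.card {m : ℤ // m ∈ T ∧ 0 ≤ m}

theorem beta_inj (μ : YoungDiagram) :
    Function.Injective fun i : ℕ => (μ.rowLen i : ℤ) - i - 1 := by
  intro i j hij
  simp only at hij
  rcases le_total i j with h | h
  · have := μ.rowLen_anti _ _ h
    omega
  · have := μ.rowLen_anti _ _ h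
    omega

theorem beta_set_eq (μ : YoungDiagram) :
    {m : ℤ | m ∈ betaSet μ ∧ 0 ≤ m} =
      (((μ.cells.filter fun c => c.1 = c.2).image
        fun c => (μ.rowLen c.1 : ℤ) - c.1 - 1 : Finset ℤ) : Set ℤ) := by
  ext m
  simp only [Set.mem_ofPred_eq, Finset.coe_image, Set.mem_image, Finset.mem_coe,
    Finset.mem_filter, YoungDiagram.mem_cells]
  constructor
  · rintro ⟨⟨i, rfl⟩, hi⟩
    simp only at hi
    exact ⟨(i, i), ⟨YoungDiagram.mem_iff_lt_rowLen.2 (by omega), rfl⟩, rfl⟩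
  · rintro ⟨⟨i, j⟩, ⟨h1, h2⟩, rfl⟩
    simp only at h2
    subst h2
    have := YoungDiagram.mem_iff_lt_rowLen.1 h1
    exact ⟨⟨i, rfl⟩, by simp only; omega⟩

theorem durfee_eq (μ : YoungDiagram) : durfee μ = pcard (betaSet μ) := by
  have h : pcard (betaSet μ) = Set.ncard {m : ℤ | m ∈ betaSet μ ∧ 0 ≤ m} := rfl
  rw [h, beta_set_eq, Set.ncard_coe_finset, Finset.card_image_of_injOn]
  · rfl
  · rintro ⟨a, b⟩ hab ⟨c, d⟩ hcd he
    simp only [Finset.coe_filter, Set.mem_ofPred_eq] at hab hcd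
    have h1 : a = c := beta_inj μ he
    ext <;> simp only <;> omega

theorem beta_finite (μ : YoungDiagram) : Finite {m : ℤ // m ∈ betaSet μ ∧ 0 ≤ m} := by
  have : Set.Finite {m : ℤ | m ∈ betaSet μ ∧ 0 ≤ m} := by
    rw [beta_set_eq]; exact Finset.finite_toSet _
  exact this

theorem pcard_sum (μ : YoungDiagram) (t : ℕ) (ht : 0 < t) :
    pcard (betaSet μ) = ∑ r ∈ Finset.range t, pcard (quotSet μ t r) := by
  have hfin := beta_finite μ
  have htz : (0 : ℤ) < t := by exact_mod_cast ht
  let F : (Σ r : Fin t, {m : ℤ // m ∈ quotSet μ t r ∧ 0 ≤ m}) →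
      {m : ℤ // m ∈ betaSet μ ∧ 0 ≤ m} :=
    fun p => ⟨(t : ℤ) * p.2.1 + (p.1 : ℕ), p.2.2.1, by
      have := p.2.2.2
      positivity⟩
  have hF : Function.Bijective F := by
    constructor
    · rintro ⟨r, m, hm⟩ ⟨r', m', hm'⟩ he
      have he : (t : ℤ) * m + (r : ℕ) = (t : ℤ) * m' + (r' : ℕ) := congrArg Subtype.val he
      have hr := r.2
      have hr' := r'.2
      have h1 : m = m' := by
        have e1 : ((t : ℤ) * m + (r : ℕ)) / t = m := by
          rw [Int.mul_add_ediv_left _ _ htz.ne', Int.ediv_eq_zero_of_lt (by omega) (by omega),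
            add_zero]
        have e2 : ((t : ℤ) * m' + (r' : ℕ)) / t = m' := by
          rw [Int.mul_add_ediv_left _ _ htz.ne', Int.ediv_eq_zero_of_lt (by omega) (by omega),
            add_zero]
        rw [← e1, he, e2]
      subst h1
      have h2 : r = r' := by ext; omega
      subst h2
      rfl
    · rintro ⟨x, hx, hx0⟩
      have h1 := Int.emod_nonneg x htz.ne'
      have h2 := Int.emod_lt_of_pos x htz
      have h3 := Int.mul_ediv_add_emod x t
      have h4 : (((x % t).toNat : ℕ) : ℤ) = x % t := Int.toNat_of_nonneg h1
      refine ⟨⟨⟨(x % t).toNat, by omega⟩, x / t, ?_, Int.ediv_nonneg hx0 htz.le⟩, ?_⟩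
      · change (t : ℤ) * (x / t) + (((x % t).toNat : ℕ) : ℤ) ∈ betaSet μ
        rw [h4, h3]; exact hx
      · apply Subtype.ext
        change (t : ℤ) * (x / t) + (((x % t).toNat : ℕ) : ℤ) = x
        rw [h4, h3]
  have hs := Finite.of_injective F hF.1
  have hq : ∀ r : Fin t, Finite {m : ℤ // m ∈ quotSet μ t r ∧ 0 ≤ m} := fun r =>
    Finite.of_injective (Sigma.mk (β := fun r : Fin t => {m : ℤ // m ∈ quotSet μ t r ∧ 0 ≤ m}) r)
      sigma_mk_injective
  rw [pcard, ← Nat.card_congr (Equiv.ofBijective F hF), Nat.card_sigma,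
    ← Fin.sum_univ_eq_sum_range (fun r => pcard (quotSet μ t r))]
  rfl

theorem ncard_zero (μ : YoungDiagram) (h : DDiagram μ) (t : ℕ) (ht : 0 < t) :
    Nat.card {m : ℤ // m ∉ quotSet μ t 0 ∧ m < 0} = pcard (quotSet μ t 0) := by
  refine Nat.card_congr (Equiv.subtypeEquiv (Equiv.neg ℤ) fun m => ?_)
  simp only [quotSet, Set.mem_ofPred_eq, Equiv.neg_apply, Nat.cast_zero, add_zero, mul_neg]
  rcases eq_or_ne m 0 with rfl | hm
  · have := dd_zero μ h
    simp [this]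
  · rw [dd_symm μ h _ (mul_ne_zero (by omega) hm)]
    have : m < 0 ↔ 0 ≤ -m := by omega
    rw [this]

theorem ncard_pos (μ : YoungDiagram) (h : DDiagram μ) (t r : ℕ) (hr : 0 < r) (hrt : r < t) :
    Nat.card {m : ℤ // m ∉ quotSet μ t r ∧ m < 0} = pcard (quotSet μ t (t - r)) := by
  refine Nat.card_congr (Equiv.subtypeEquiv (Equiv.subLeft (-1)) fun m => ?_)
  simp only [quotSet, Set.mem_ofPred_eq, Equiv.subLeft_apply]
  have hne : (t : ℤ) * m + r ≠ 0 := by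
    intro h0
    have : (t : ℤ) ∣ r := ⟨-m, by linarith⟩
    have := Nat.le_of_dvd hr (Int.natCast_dvd_natCast.1 this)
    omega
  have he : (t : ℤ) * (-1 - m) + ((t - r : ℕ) : ℤ) = -((t : ℤ) * m + r) := by
    rw [Nat.cast_sub hrt.le]; ring
  rw [he, dd_symm μ h _ hne]
  have : m < 0 ↔ 0 ≤ -1 - m := by omega
  rw [this]

theorem charge_eq_zero (μ : YoungDiagram) (h : DDiagram μ) (t : ℕ) (ht : 0 < t) :
    charge (quotSet μ t 0) = 0 := by
  rw [charge, ncard_zero μ h t ht, pcard, sub_self]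

theorem charge_pos (μ : YoungDiagram) (h : DDiagram μ) (t r : ℕ) (hr : 0 < r) (hrt : r < t) :
    charge (quotSet μ t r) = (pcard (quotSet μ t r) : ℤ) - pcard (quotSet μ t (t - r)) := by
  rw [charge, ncard_pos μ h t r hr hrt]; rfl

theorem durfee_of_charge (T : Set ℤ) (h : charge T = 0) : durfeeOfSet T = pcard T := by
  rw [durfeeOfSet, h, pcard]

/-- The summand whose parity is studied. -/
def ff (μ : YoungDiagram) (t r : ℕ) : ℕ :=
  pcard (quotSet μ t r) + (charge (quotSet μ t r)).toNat

theorem ff_pair (μ : YoungDiagram) (h : DDiagram μ) (t r : ℕ) (hr : 0 < r) (hrt : r < t) :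
    (ff μ t r : ZMod 2) + (ff μ t (t - r) : ZMod 2) = 0 := by
  have h1 := charge_pos μ h t r hr hrt
  have h2 := charge_pos μ h t (t - r) (by omega) (by omega)
  rw [show t - (t - r) = r by omega] at h2
  rw [← Nat.cast_add, ZMod.natCast_eq_zero_iff]
  unfold ff
  omega

theorem ff_sum (μ : YoungDiagram) (t : ℕ) (ht : 0 < t) :
    durfee μ + coreDurfee μ t = ∑ r ∈ Finset.range t, ff μ t r := by
  rw [durfee_eq, pcard_sum μ t ht, coreDurfee, ← Finset.sum_add_distrib]
  rfl

theorem littlewood_delta_DD (t : ℕ) (ht : 0 < t) (μ : YoungDiagram)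
    (hdd : DDiagram μ) :
    (Odd t → ((-1 : ℤ) ^ durfee μ =
      (-1) ^ coreDurfee μ t * (-1) ^ quotDurfee μ t 0)) ∧
    (Even t → ((-1 : ℤ) ^ durfee μ =
      (-1) ^ coreDurfee μ t * (-1) ^ quotDurfee μ t 0 * (-1) ^ quotDurfee μ t (t / 2))) := by
  have hz : quotDurfee μ t 0 = ff μ t 0 := by
    rw [quotDurfee, durfee_of_charge _ (charge_eq_zero μ hdd t ht), ff,
      charge_eq_zero μ hdd t ht]
    simp
  have hsum := ff_sum μ t ht
  have key : ∀ s : Finset ℕ, (∀ r ∈ s, 0 < r ∧ r < t ∧ t - r ≠ r ∧ t - r ∈ s) →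
      2 ∣ ∑ r ∈ s, ff μ t r := by
    intro s hs
    rw [← ZMod.natCast_eq_zero_iff, Nat.cast_sum]
    exact Finset.sum_involution (fun r _ => t - r)
      (fun r hr => ff_pair μ hdd t r (hs r hr).1 (hs r hr).2.1)
      (fun r hr _ => (hs r hr).2.2.1) (fun r hr => (hs r hr).2.2.2)
      (fun r hr => by have := (hs r hr).2.1; omega)
  have h0 : 0 ∈ Finset.range t := Finset.mem_range.2 ht
  rw [← Finset.add_sum_erase _ _ h0] at hsum
  constructor
  · rintro ⟨k, hk⟩
    have h1 := key ((Finset.range t).erase 0) (by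
      intro r hr
      simp only [Finset.mem_erase, Finset.mem_range] at hr ⊢
      omega)
    rw [← pow_add]
    apply neg_one_pow_congr
    rw [Nat.even_iff, Nat.even_iff]
    omega
  · rintro ⟨k, hk⟩
    have hm : t / 2 ∈ (Finset.range t).erase 0 := by
      simp only [Finset.mem_erase, Finset.mem_range]
      omega
    rw [← Finset.add_sum_erase _ _ hm] at hsum
    have hc : charge (quotSet μ t (t / 2)) = 0 := by
      rw [charge_pos μ hdd t (t / 2) (by omega) (by omega), show t - t / 2 = t / 2 by omega,
        sub_self]
    have hh : quotDurfee μ t (t / 2) = ff μ t (t / 2) := by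
      rw [quotDurfee, durfee_of_charge _ hc, ff, hc]
      simp
    have h1 := key (((Finset.range t).erase 0).erase (t / 2)) (by
      intro r hr
      simp only [Finset.mem_erase, Finset.mem_range] at hr ⊢
      omega)
    rw [← pow_add, ← pow_add]
    apply neg_one_pow_congr
    rw [Nat.even_iff, Nat.even_iff]
    omega
end
end

section
/- Let t = 2t' be an even positive integer. The signed generating function of doubled distinct t-cores satisfies: Σ_{λ̃ ∈ DD_{(t)}} δ_{λ̃} x^{|λ̃|/2} = ∏_{k≥1} (1-x^k)(1-x^{kt})^{t'-1}/(1-x^{kt'}). -/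
/-!
Statement 13 (Lemma `seriegen`): for `t = 2t'` an even positive integer, the
signed generating function of doubled distinct `t`-cores satisfies
Σ_{λ̃ ∈ DD_{(t)}} δ_{λ̃} x^{|λ̃|/2}
  = ∏_{k≥1} (1-x^k)(1-x^{kt})^{t'-1}/(1-x^{kt'}),
as a formal power series over ℤ. (Doubled distinct partitions have even weight.)
-/

noncomputable section

open PowerSeries

/-- Product (pi) topology on formal power series. -/
instance {R : Type*} [TopologicalSpace R] : TopologicalSpace (PowerSeries R) :=
  inferInstanceAs (TopologicalSpace ((Unit →₀ ℕ) → R))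

/-- The hook length of the box `c = (i, j)` (0-indexed) of a Young diagram. -/
def hookLen (μ : YoungDiagram) (c : ℕ × ℕ) : ℕ :=
  μ.rowLen c.1 + μ.colLen c.2 - c.1 - c.2 - 1

/-- number of elements of `S` that are at least `x` -/
def cntGE (S : Finset ℕ) (x : ℕ) : ℕ := (S.filter fun s => x ≤ s).card

lemma cntGE_anti (S : Finset ℕ) {x y : ℕ} (h : x ≤ y) : cntGE S y ≤ cntGE S x := by
  apply Finset.card_le_card
  intro s hs
  simp only [Finset.mem_filter] at hs ⊢
  exact ⟨hs.1, h.trans hs.2⟩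

lemma cntGE_succ (S : Finset ℕ) (x : ℕ) :
    cntGE S x = cntGE S (x + 1) + if x ∈ S then 1 else 0 := by
  unfold cntGE
  have : (S.filter fun s => x ≤ s) = (S.filter fun s => x + 1 ≤ s) ∪ (S.filter fun s => s = x) := by
    ext s
    simp only [Finset.mem_filter, Finset.mem_union]
    constructor
    · rintro ⟨h1, h2⟩
      rcases Nat.lt_or_ge x s with h | h
      · exact Or.inl ⟨h1, h⟩
      · exact Or.inr ⟨h1, by omega⟩
    · rintro (⟨h1, h2⟩ | ⟨h1, h2⟩)
      · exact ⟨h1, by omega⟩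
      · exact ⟨h1, by omega⟩
  rw [this, Finset.card_union_of_disjoint]
  · congr 1
    rw [Finset.filter_eq']
    split_ifs <;> simp
  · rw [Finset.disjoint_left]
    intro s hs hs'
    simp only [Finset.mem_filter] at hs hs'
    omega

lemma cntGE_add (S : Finset ℕ) (x k : ℕ) : cntGE S x ≤ cntGE S (x + k) + k := by
  induction k with
  | zero => simp
  | succ k ih =>
    have := cntGE_succ S (x + k)
    have h2 : x + (k + 1) = x + k + 1 := by ring
    rw [h2]
    split_ifs at this <;> omega

lemma cntGE_inj {S S' : Finset ℕ} (h0 : 0 ∉ S) (h0' : 0 ∉ S')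
    (h : ∀ x, 1 ≤ x → cntGE S x = cntGE S' x) : S = S' := by
  ext s
  rcases Nat.eq_zero_or_pos s with rfl | hs
  · simp [h0, h0']
  · have h1 := cntGE_succ S s
    have h2 := cntGE_succ S' s
    rw [h s hs, h (s+1) (by omega)] at h1
    by_cases a : s ∈ S <;> by_cases b : s ∈ S' <;> simp_all

/-- The doubled distinct diagram attached to a finite set. -/
def ddOf (S : Finset ℕ) : YoungDiagram where
  cells := ((Finset.range (S.card + S.sup id + 2)) ×ˢ (Finset.range (S.card + S.sup id + 2))).filter
    fun c => if c.1 < c.2 then c.1 < cntGE S (c.2 - c.1) else c.2 < cntGE S (c.1 + 1 - c.2)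
  isLowerSet := by
    rintro ⟨i, j⟩ ⟨i', j'⟩ ⟨h1, h2⟩ h
    simp only [Finset.coe_filter, Finset.mem_product, Finset.mem_range, Set.mem_ofPred_eq] at h h1 h2 ⊢
    refine ⟨by omega, ?_⟩
    obtain ⟨-, h⟩ := h
    split_ifs at h ⊢ with a b b
    · have e1 := cntGE_add S (j - i) (i - i')
      have e2 := cntGE_anti S (x := j' - i') (y := j - i + (i - i')) (by omega)
      omega
    · have e1 := cntGE_add S (i + 1 - j) (j - i')
      have e2 := cntGE_anti S (x := j' - i') (y := i + 1 - j + (j - i')) (by omega)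
      omega
    · have e1 := cntGE_add S (j - i) (i - j')
      have e2 := cntGE_anti S (x := i' + 1 - j') (y := j - i + (i - j')) (by omega)
      omega
    · have e1 := cntGE_add S (i + 1 - j) (j - j')
      have e2 := cntGE_anti S (x := i' + 1 - j') (y := i + 1 - j + (j - j')) (by omega)
      omega

lemma cntGE_lt {S : Finset ℕ} {i x : ℕ} (h : i < cntGE S x) : i < S.card ∧ x ≤ S.sup id := by
  constructor
  · exact h.trans_le (Finset.card_filter_le _ _)
  · have : 0 < cntGE S x := by omega
    obtain ⟨s, hs⟩ := Finset.card_pos.1 this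
    simp only [Finset.mem_filter] at hs
    exact hs.2.trans (Finset.le_sup (f := id) hs.1)

lemma mem_ddOf (S : Finset ℕ) (i j : ℕ) : (i, j) ∈ ddOf S ↔
    if i < j then i < cntGE S (j - i) else j < cntGE S (i + 1 - j) := by
  rw [← YoungDiagram.mem_cells]
  simp only [ddOf, Finset.mem_filter, Finset.mem_product, Finset.mem_range]
  constructor
  · exact fun h => h.2
  · intro h
    refine ⟨?_, h⟩
    split_ifs at h with a
    · have := cntGE_lt h; omega
    · have := cntGE_lt h; omega

lemma dd_iff (μ : YoungDiagram) : DDiagram μ ↔ ∀ i j, j ≤ i → ((i, j) ∈ μ ↔ (j, i + 1) ∈ μ) := by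
  constructor
  · intro h i j hij
    by_cases hj : (j, j) ∈ μ
    · have := h j hj
      rw [YoungDiagram.mem_iff_lt_colLen, YoungDiagram.mem_iff_lt_rowLen]
      omega
    · constructor
      · intro h'; exact absurd (μ.up_left_mem hij le_rfl h') hj
      · intro h'; exact absurd (μ.up_left_mem le_rfl (by omega) h') hj
  · intro h i hi
    have hi2 := YoungDiagram.mem_iff_lt_colLen.1 hi
    have h1 := h (μ.colLen i) i (by omega)
    have h2 := h (μ.colLen i - 1) i (by omega)
    rw [YoungDiagram.mem_iff_lt_colLen, YoungDiagram.mem_iff_lt_rowLen] at h1 h2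
    omega

lemma dd_ddOf (S : Finset ℕ) : DDiagram (ddOf S) := by
  rw [dd_iff]
  intro i j hij
  rw [mem_ddOf, mem_ddOf, if_neg (by omega), if_pos (by omega)]

lemma durfee_spec (μ : YoungDiagram) (i : ℕ) : (i, i) ∈ μ ↔ i < durfee μ := by
  have hex : ∃ n, (n, n) ∉ μ := by
    obtain ⟨n, hn⟩ := μ.exists_notMem_row 0
    exact ⟨n, fun h => hn (μ.up_left_mem (Nat.zero_le _) le_rfl h)⟩
  classical
  have key : ∀ i, (i, i) ∈ μ ↔ i < Nat.find hex := by
    intro i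
    rw [Nat.lt_find_iff]
    constructor
    · intro h m hm h'; exact h' (μ.up_left_mem hm hm h)
    · intro h; simpa using h i le_rfl
  have : durfee μ = Nat.find hex := by
    unfold durfee
    have : (μ.cells.filter fun c => c.1 = c.2) = (Finset.range (Nat.find hex)).image (fun i => (i, i)) := by
      ext ⟨a, b⟩
      simp only [Finset.mem_filter, Finset.mem_image, Finset.mem_range, Prod.mk.injEq,
        YoungDiagram.mem_cells]
      constructor
      · rintro ⟨h1, rfl⟩; exact ⟨a, (key a).1 h1, rfl, rfl⟩
      · rintro ⟨k, h1, rfl, rfl⟩; exact ⟨(key k).2 h1, rfl⟩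
    rw [this, Finset.card_image_of_injective _ (fun a b h => by simpa using h), Finset.card_range]
  rw [this]; exact key i

/-- the arm lengths of the diagonal cells -/
def arms (μ : YoungDiagram) : Finset ℕ := (Finset.range (durfee μ)).image fun i => μ.rowLen i - i - 1

lemma diag_row {μ : YoungDiagram} (h : DDiagram μ) {i : ℕ} (hi : i < durfee μ) :
    i + 2 ≤ μ.rowLen i ∧ μ.rowLen i = μ.colLen i + 1 := by
  have h1 := h i ((durfee_spec μ i).2 hi)
  have h2 := YoungDiagram.mem_iff_lt_colLen.1 ((durfee_spec μ i).2 hi)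
  omega

lemma arms_injOn (μ : YoungDiagram) :
    Set.InjOn (fun i => μ.rowLen i - i - 1) (Finset.range (durfee μ)) := by
  have key : ∀ a b, a < b → b < durfee μ → μ.rowLen a - a - 1 ≠ μ.rowLen b - b - 1 := by
    intro a b hab hb
    have h1 := μ.rowLen_anti a b hab.le
    have h2 := YoungDiagram.mem_iff_lt_rowLen.1 ((durfee_spec μ b).2 hb)
    omega
  intro a ha b hb hab
  simp only [Finset.coe_range, Set.mem_Iio] at ha hb
  rcases lt_trichotomy a b with h | h | h
  · exact absurd hab (key a b h hb)
  · exact h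
  · exact absurd hab.symm (key b a h ha)

lemma zero_notMem_arms {μ : YoungDiagram} (h : DDiagram μ) : 0 ∉ arms μ := by
  simp only [arms, Finset.mem_image, Finset.mem_range, not_exists, not_and]
  intro i hi
  have := diag_row h hi
  omega

lemma card_arms (μ : YoungDiagram) : (arms μ).card = durfee μ := by
  rw [arms, Finset.card_image_of_injOn (arms_injOn μ), Finset.card_range]

lemma mem_iff_arms (μ : YoungDiagram) (i x : ℕ) (hx : 1 ≤ x) :
    (i, i + x) ∈ μ ↔ i < cntGE (arms μ) x := by
  have anti : ∀ a b, a ≤ b → (b, b + x) ∈ μ → (a, a + x) ∈ μ :=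
    fun a b hab h => μ.up_left_mem hab (by omega) h
  have hcnt : cntGE (arms μ) x = ((Finset.range (durfee μ)).filter fun i => (i, i + x) ∈ μ).card := by
    unfold cntGE arms
    rw [Finset.filter_image, Finset.card_image_of_injOn ((arms_injOn μ).mono (by
      intro a ha; simp only [Finset.coe_filter, Set.mem_ofPred_eq] at ha; exact ha.1))]
    congr 1
    apply Finset.filter_congr
    intro i hi
    rw [YoungDiagram.mem_iff_lt_rowLen]
    omega
  have hd : ∀ i, (i, i + x) ∈ μ → i < durfee μ := fun i h =>
    (durfee_spec μ i).1 (μ.up_left_mem le_rfl (by omega) h)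
  rw [hcnt]
  constructor
  · intro h
    have : Finset.range (i + 1) ⊆ (Finset.range (durfee μ)).filter fun i => (i, i + x) ∈ μ := by
      intro a ha
      simp only [Finset.mem_range, Finset.mem_filter] at ha ⊢
      have := anti a i (by omega) h
      exact ⟨hd a this, this⟩
    have := Finset.card_le_card this
    rw [Finset.card_range] at this
    omega
  · intro h
    by_contra hn
    have : ((Finset.range (durfee μ)).filter fun i => (i, i + x) ∈ μ) ⊆ Finset.range i := by
      intro a ha
      simp only [Finset.mem_range, Finset.mem_filter] at ha ⊢
      by_contra hia
      exact hn (anti i a (by omega) ha.2)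
    have := Finset.card_le_card this
    rw [Finset.card_range] at this
    omega

lemma arms_ddOf {S : Finset ℕ} (h0 : 0 ∉ S) : arms (ddOf S) = S := by
  apply cntGE_inj (zero_notMem_arms (dd_ddOf S)) h0
  intro x hx
  have : ∀ i, i < cntGE (arms (ddOf S)) x ↔ i < cntGE S x := by
    intro i
    rw [← mem_iff_arms _ _ _ hx, mem_ddOf, if_pos (by omega)]
    simp
  apply le_antisymm
  · by_contra h; have := (this (cntGE S x)).1 (by omega); omega
  · by_contra h; have := (this (cntGE (arms (ddOf S)) x)).2 (by omega); omega

lemma mem_dd_iff {μ : YoungDiagram} (h : DDiagram μ) (i j : ℕ) : (i, j) ∈ μ ↔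
    if i < j then i < cntGE (arms μ) (j - i) else j < cntGE (arms μ) (i + 1 - j) := by
  split_ifs with a
  · rw [← mem_iff_arms _ _ _ (by omega)]
    rw [show i + (j - i) = j by omega]
  · rw [← mem_iff_arms _ _ _ (by omega), (dd_iff μ).1 h i j (by omega)]
    rw [show j + (i + 1 - j) = i + 1 by omega]

lemma ddOf_arms {μ : YoungDiagram} (h : DDiagram μ) : ddOf (arms μ) = μ := by
  apply SetLike.ext
  rintro ⟨i, j⟩
  rw [mem_ddOf, mem_dd_iff h]

lemma card_dd {μ : YoungDiagram} (h : DDiagram μ) : μ.card = 2 * ∑ s ∈ arms μ, s := by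
  have hd := (dd_iff μ).1 h
  have h1 : (μ.cells.filter fun c => c.1 < c.2).card = ∑ s ∈ arms μ, s := by
    have : (μ.cells.filter fun c => c.1 < c.2) =
        (Finset.range (durfee μ)).biUnion
          (fun i => (Finset.Ico (i + 1) (μ.rowLen i)).image fun j => (i, j)) := by
      ext ⟨a, b⟩
      simp only [Finset.mem_filter, Finset.mem_biUnion, Finset.mem_image, Finset.mem_range,
        Prod.mk.injEq, YoungDiagram.mem_cells, Finset.mem_Ico]
      constructor
      · rintro ⟨h1, h2⟩
        exact ⟨a, (durfee_spec μ a).1 (μ.up_left_mem le_rfl h2.le h1), b,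
          ⟨h2, YoungDiagram.mem_iff_lt_rowLen.1 h1⟩, rfl, rfl⟩
      · rintro ⟨k, h1, l, h2, rfl, rfl⟩
        exact ⟨YoungDiagram.mem_iff_lt_rowLen.2 h2.2, h2.1⟩
    rw [this, Finset.card_biUnion, arms, Finset.sum_image (arms_injOn μ)]
    · apply Finset.sum_congr rfl
      intro i hi
      rw [Finset.card_image_of_injective _ (fun a b h => by simpa using h), Nat.card_Ico]
      omega
    · intro a ha b hb hab
      rw [Function.onFun, Finset.disjoint_left]
      rintro ⟨c, d⟩ h1 h2
      simp only [Finset.mem_image, Prod.mk.injEq] at h1 h2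
      obtain ⟨_, _, rfl, _⟩ := h1
      obtain ⟨_, _, h3, _⟩ := h2
      exact hab h3.symm
  have h2 : (μ.cells.filter fun c => ¬ c.1 < c.2).card = (μ.cells.filter fun c => c.1 < c.2).card := by
    refine Finset.card_bij' (fun c _ => (c.2, c.1 + 1)) (fun c _ => (c.2 - 1, c.1)) ?_ ?_ ?_ ?_
    · rintro ⟨i, j⟩ hc
      simp only [Finset.mem_filter, YoungDiagram.mem_cells] at hc ⊢
      exact ⟨(hd i j (by omega)).1 hc.1, by omega⟩
    · rintro ⟨i, j⟩ hc
      simp only [Finset.mem_filter, YoungDiagram.mem_cells] at hc ⊢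
      refine ⟨(hd (j - 1) i (by omega)).2 ?_, by omega⟩
      rw [show j - 1 + 1 = j by omega]; exact hc.1
    · rintro ⟨i, j⟩ hc
      simp
    · rintro ⟨i, j⟩ hc
      simp only [Finset.mem_filter, YoungDiagram.mem_cells] at hc ⊢
      show (i, j - 1 + 1) = (i, j)
      rw [show j - 1 + 1 = j by omega]
  have h3 := Finset.card_filter_add_card_filter_not (s := μ.cells) (fun c => c.1 < c.2)
  rw [h2, h1] at h3
  rw [YoungDiagram.card, ← h3]; ring

/-- The core condition on the set of arm lengths. -/
def CoreSet (t : ℕ) (S : Finset ℕ) : Prop :=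
  ∀ s ∈ S, (∀ s' ∈ S, ¬ t ∣ s + s') ∧ ∀ u, u ∉ S → u < s → ¬ t ∣ s - u

lemma core_iff {μ : YoungDiagram} (h : DDiagram μ) (t : ℕ) :
    (∀ c ∈ μ.cells, ¬ t ∣ hookLen μ c) ↔ CoreSet t (arms μ) := by
  have hsq : ∀ i j, i < durfee μ → j < durfee μ → (i, j) ∈ μ := by
    intro i j hi hj
    have := (durfee_spec μ (max i j)).2 (by simp [hi, hj])
    exact μ.up_left_mem (le_max_left _ _) (le_max_right _ _) this
  have harm : ∀ i, i < durfee μ → μ.rowLen i - i - 1 ∈ arms μ := fun i hi =>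
    Finset.mem_image.2 ⟨i, Finset.mem_range.2 hi, rfl⟩
  constructor
  · intro H s hs
    obtain ⟨i, hi, rfl⟩ := Finset.mem_image.1 hs
    rw [Finset.mem_range] at hi
    have di := diag_row h hi
    constructor
    · intro s' hs'
      obtain ⟨j, hj, rfl⟩ := Finset.mem_image.1 hs'
      rw [Finset.mem_range] at hj
      have dj := diag_row h hj
      have := H (i, j) ((YoungDiagram.mem_cells _).2 (hsq i j hi hj))
      unfold hookLen at this
      simp only at this
      convert this using 2
      omega
    · intro u hu hlt
      set n := cntGE (arms μ) (u + 1) with hn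
      have hnu : cntGE (arms μ) u = n := by
        have := cntGE_succ (arms μ) u
        rw [if_neg hu] at this; omega
      have hin : i < n := by
        rw [hn, ← mem_iff_arms _ _ _ (by omega), YoungDiagram.mem_iff_lt_rowLen]
        omega
      have m1 : (n - 1, u + n) ∈ μ := by
        rw [show u + n = n - 1 + (u + 1) by omega, mem_iff_arms _ _ _ (by omega), ← hn]
        omega
      have m2 : (n, u + n) ∉ μ := by
        rw [mem_dd_iff h]
        split_ifs with a
        · rw [show u + n - n = u by omega, hnu]; omega
        · have : u = 0 := by omega
          subst this
          rw [show n + 1 - (0 + n) = 0 + 1 by omega, ← hn]; omega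
      rw [YoungDiagram.mem_iff_lt_colLen] at m1 m2
      have m3 : (i, u + n) ∈ μ := by
        rw [YoungDiagram.mem_iff_lt_colLen]; omega
      have := H _ ((YoungDiagram.mem_cells _).2 m3)
      unfold hookLen at this
      simp only at this
      convert this using 2
      omega
  · rintro H ⟨i, j⟩ hc
    rw [YoungDiagram.mem_cells] at hc
    have r1 := YoungDiagram.mem_iff_lt_rowLen.1 hc
    have c1 := YoungDiagram.mem_iff_lt_colLen.1 hc
    unfold hookLen
    simp only
    by_cases hi : i < durfee μ
    · have di := diag_row h hi
      by_cases hj : j < durfee μ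
      · have dj := diag_row h hj
        have := (H _ (harm i hi)).1 _ (harm j hj)
        convert this using 2
        omega
      · have hjj : ¬ (j, j) ∈ μ := fun h' => hj ((durfee_spec μ j).1 h')
        have hjj' := hjj
        rw [YoungDiagram.mem_iff_lt_colLen] at hjj
        have := (H _ (harm i hi)).2 (j - μ.colLen j) (by
          intro hm
          obtain ⟨k, hk, hk2⟩ := Finset.mem_image.1 hm
          rw [Finset.mem_range] at hk
          have dk := diag_row h hk
          have e : j < μ.rowLen k ↔ k < μ.colLen j := by
            rw [← YoungDiagram.mem_iff_lt_rowLen, ← YoungDiagram.mem_iff_lt_colLen]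
          by_cases j < μ.rowLen k
          · omega
          · omega) (by omega)
        convert this using 2
        omega
    · have hii : ¬ (i, i) ∈ μ := fun h' => hi ((durfee_spec μ i).1 h')
      have hii' := hii
      rw [YoungDiagram.mem_iff_lt_rowLen] at hii
      have hj : j < durfee μ := by
        by_contra hj
        rw [← durfee_spec] at hj
        rcases le_total i j with hij | hij
        · exact hii' (μ.up_left_mem le_rfl hij hc)
        · exact hj (μ.up_left_mem hij le_rfl hc)
      have dj := diag_row h hj
      have := (H _ (harm j hj)).2 (i + 1 - μ.rowLen i) (by
          intro hm
          obtain ⟨k, hk, hk2⟩ := Finset.mem_image.1 hm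
          rw [Finset.mem_range] at hk
          have dk := diag_row h hk
          have e : k < μ.rowLen i ↔ i < μ.colLen k := by
            rw [← YoungDiagram.mem_iff_lt_rowLen, ← YoungDiagram.mem_iff_lt_colLen]
          by_cases k < μ.rowLen i
          · omega
          · omega) (by omega)
      convert this using 2
      omega

/-- doubled distinct cores are core sets -/
def ddEquiv (t : ℕ) : {μ : YoungDiagram // DDiagram μ ∧ ∀ c ∈ μ.cells, ¬ t ∣ hookLen μ c} ≃
    {S : Finset ℕ // 0 ∉ S ∧ CoreSet t S} where
  toFun μ := ⟨arms μ.1, zero_notMem_arms μ.2.1, (core_iff μ.2.1 t).1 μ.2.2⟩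
  invFun S := ⟨ddOf S.1, dd_ddOf _, (core_iff (dd_ddOf _) t).2 (by
    rw [arms_ddOf S.2.1]; exact S.2.2)⟩
  left_inv μ := Subtype.ext (ddOf_arms μ.2.1)
  right_inv S := Subtype.ext (arms_ddOf S.2.1)
lemma res_uniq {t r r' k k' : ℕ} (h : r < t) (h' : r' < t) (e : r + t * k = r' + t * k') :
    r = r' ∧ k = k' := by
  have h1 : (r + t * k) % t = r := by rw [Nat.add_mul_mod_self_left, Nat.mod_eq_of_lt h]
  have h2 : (r' + t * k') % t = r' := by rw [Nat.add_mul_mod_self_left, Nat.mod_eq_of_lt h']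
  have h3 : r = r' := by rw [← h1, ← h2, e]
  subst h3
  refine ⟨rfl, ?_⟩
  have : t * k = t * k' := by omega
  exact Nat.eq_of_mul_eq_mul_left (by omega) this

/-- part of a core set in the residue classes `r` and `-r` -/
def cls (t r : ℕ) (c : ℤ) : Finset ℕ :=
  (Finset.range c.toNat).image (fun k => r + t * k) ∪
    (Finset.range (-c).toNat).image (fun k => (t - r) + t * k)

lemma mem_cls {t r : ℕ} {c : ℤ} {s : ℕ} : s ∈ cls t r c ↔
    (∃ k : ℕ, (k : ℤ) < c ∧ s = r + t * k) ∨ ∃ k : ℕ, (k : ℤ) < -c ∧ s = (t - r) + t * k := by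
  simp only [cls, Finset.mem_union, Finset.mem_image, Finset.mem_range]
  constructor
  · rintro (⟨k, h, rfl⟩ | ⟨k, h, rfl⟩)
    · exact Or.inl ⟨k, by omega, rfl⟩
    · exact Or.inr ⟨k, by omega, rfl⟩
  · rintro (⟨k, h, rfl⟩ | ⟨k, h, rfl⟩)
    · exact Or.inl ⟨k, by omega, rfl⟩
    · exact Or.inr ⟨k, by omega, rfl⟩

/-- core set attached to an integer vector -/
def coreOf (n : ℕ) (c : Fin n → ℤ) : Finset ℕ :=
  Finset.univ.biUnion fun i : Fin n => cls (2 * (n + 1)) (i + 1) (c i)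

lemma mem_coreOf {n : ℕ} {c : Fin n → ℤ} {s : ℕ} : s ∈ coreOf n c ↔
    ∃ i : Fin n, (∃ k : ℕ, (k : ℤ) < c i ∧ s = (i + 1) + (2 * (n + 1)) * k) ∨
      ∃ k : ℕ, (k : ℤ) < -c i ∧ s = (2 * (n + 1) - (i + 1)) + (2 * (n + 1)) * k := by
  simp only [coreOf, Finset.mem_biUnion, Finset.mem_univ, true_and, mem_cls]

lemma mem_coreOf_pos {n : ℕ} {c : Fin n → ℤ} (i : Fin n) (k : ℕ) :
    (i + 1) + (2 * (n + 1)) * k ∈ coreOf n c ↔ (k : ℤ) < c i := by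
  rw [mem_coreOf]
  constructor
  · rintro ⟨j, (⟨l, h1, h2⟩ | ⟨l, h1, h2⟩)⟩
    · obtain ⟨h3, rfl⟩ := res_uniq (by omega) (by omega) h2
      have : i = j := Fin.ext (by omega)
      rwa [this]
    · obtain ⟨h3, rfl⟩ := res_uniq (by omega) (by omega) h2
      omega
  · intro h; exact ⟨i, Or.inl ⟨k, h, rfl⟩⟩

lemma mem_coreOf_neg {n : ℕ} {c : Fin n → ℤ} (i : Fin n) (k : ℕ) :
    (2 * (n + 1) - (i + 1)) + (2 * (n + 1)) * k ∈ coreOf n c ↔ (k : ℤ) < -c i := by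
  rw [mem_coreOf]
  constructor
  · rintro ⟨j, (⟨l, h1, h2⟩ | ⟨l, h1, h2⟩)⟩
    · obtain ⟨h3, rfl⟩ := res_uniq (by omega) (by omega) h2
      omega
    · obtain ⟨h3, rfl⟩ := res_uniq (by omega) (by omega) h2
      have : i = j := Fin.ext (by omega)
      rwa [this]
  · intro h; exact ⟨i, Or.inr ⟨k, h, rfl⟩⟩

lemma notMem_coreOf_zero {n : ℕ} {c : Fin n → ℤ} (k : ℕ) : 0 + (2 * (n + 1)) * k ∉ coreOf n c := by
  rw [mem_coreOf]
  rintro ⟨j, (⟨l, h1, h2⟩ | ⟨l, h1, h2⟩)⟩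
  · obtain ⟨h3, rfl⟩ := res_uniq (by omega) (by omega) h2
    omega
  · obtain ⟨h3, rfl⟩ := res_uniq (by omega) (by omega) h2
    omega

lemma notMem_coreOf_half {n : ℕ} {c : Fin n → ℤ} (k : ℕ) :
    (n + 1) + (2 * (n + 1)) * k ∉ coreOf n c := by
  rw [mem_coreOf]
  rintro ⟨j, (⟨l, h1, h2⟩ | ⟨l, h1, h2⟩)⟩
  · obtain ⟨h3, rfl⟩ := res_uniq (by omega) (by omega) h2
    omega
  · obtain ⟨h3, rfl⟩ := res_uniq (by omega) (by omega) h2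
    omega

lemma classify (n s : ℕ) : (∃ k, s = 0 + (2 * (n + 1)) * k) ∨ (∃ k, s = (n + 1) + (2 * (n + 1)) * k) ∨
    ∃ i : Fin n, (∃ k, s = (i + 1) + (2 * (n + 1)) * k) ∨
      ∃ k, s = (2 * (n + 1) - (i + 1)) + (2 * (n + 1)) * k := by
  have h := Nat.mod_add_div s (2 * (n + 1))
  have hlt := Nat.mod_lt s (show 2 * (n + 1) > 0 by omega)
  generalize s % (2 * (n + 1)) = r at h hlt
  generalize s / (2 * (n + 1)) = q at h
  rcases Nat.eq_zero_or_pos r with h0 | h0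
  · exact Or.inl ⟨q, by omega⟩
  rcases lt_trichotomy r (n + 1) with h1 | h1 | h1
  · exact Or.inr (Or.inr ⟨⟨r - 1, by omega⟩, Or.inl ⟨q, by simp only; omega⟩⟩)
  · exact Or.inr (Or.inl ⟨q, by omega⟩)
  · exact Or.inr (Or.inr ⟨⟨2 * (n + 1) - r - 1, by omega⟩, Or.inr ⟨q, by simp only; omega⟩⟩)

lemma dvd_sub_res {t r k u : ℕ} (hr : r < t) (hu : u < r + t * k) (hd : t ∣ r + t * k - u) :
    ∃ k', k' < k ∧ u = r + t * k' := by
  obtain ⟨m, hm⟩ := hd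
  have hm0 : 0 < m := by
    rcases Nat.eq_zero_or_pos m with h | h
    · subst h; omega
    · exact h
  have hmk : m ≤ k := by
    by_contra h
    have : t * (k + 1) ≤ t * m := Nat.mul_le_mul_left _ (by omega)
    rw [Nat.mul_add] at this
    omega
  refine ⟨k - m, by omega, ?_⟩
  have : t * k = t * (k - m) + t * m := by rw [← Nat.mul_add]; congr 1; omega
  omega

lemma dvd_add_res {t r k s : ℕ} (hr : r < t) (hr0 : 0 < r) (hd : t ∣ r + t * k + s) :
    ∃ k', s = (t - r) + t * k' := by
  have h1 : t ∣ r + s := by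
    have : r + t * k + s = t * k + (r + s) := by ring
    rw [this] at hd
    exact (Nat.dvd_add_right (Dvd.intro _ rfl)).1 hd
  obtain ⟨m, hm⟩ := h1
  have : 0 < m := by
    rcases Nat.eq_zero_or_pos m with h | h
    · subst h; omega
    · exact h
  refine ⟨m - 1, ?_⟩
  have : t * m = t * (m - 1) + t := by
    conv_lhs => rw [show m = m - 1 + 1 by omega, Nat.mul_add]
    omega
  omega

lemma coreOf_core (n : ℕ) (c : Fin n → ℤ) : 0 ∉ coreOf n c ∧ CoreSet (2 * (n + 1)) (coreOf n c) := by
  refine ⟨by simpa using notMem_coreOf_zero (c := c) 0, ?_⟩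
  intro s hs
  rcases classify n s with ⟨k, rfl⟩ | ⟨k, rfl⟩ | ⟨i, ⟨k, rfl⟩ | ⟨k, rfl⟩⟩
  · exact absurd hs (notMem_coreOf_zero k)
  · exact absurd hs (notMem_coreOf_half k)
  · rw [mem_coreOf_pos] at hs
    constructor
    · intro s' hs' hd
      obtain ⟨k', rfl⟩ := dvd_add_res (by omega) (by omega) hd
      rw [mem_coreOf_neg] at hs'
      omega
    · intro u hu hlt hd
      obtain ⟨k', h, rfl⟩ := dvd_sub_res (by omega) hlt hd
      rw [mem_coreOf_pos] at hu
      omega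
  · rw [mem_coreOf_neg] at hs
    constructor
    · intro s' hs' hd
      obtain ⟨k', rfl⟩ := dvd_add_res (by omega) (by omega) hd
      rw [show 2 * (n + 1) - (2 * (n + 1) - (i.val + 1)) = i.val + 1 by omega, mem_coreOf_pos] at hs'
      omega
    · intro u hu hlt hd
      obtain ⟨k', h, rfl⟩ := dvd_sub_res (by omega) hlt hd
      rw [mem_coreOf_neg] at hu
      omega

lemma coreOf_inj (n : ℕ) (c c' : Fin n → ℤ) (h : coreOf n c = coreOf n c') : c = c' := by
  funext i
  have h1 : ∀ k : ℕ, (k : ℤ) < c i ↔ (k : ℤ) < c' i := fun k => by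
    rw [← mem_coreOf_pos, ← mem_coreOf_pos, h]
  have h2 : ∀ k : ℕ, (k : ℤ) < -c i ↔ (k : ℤ) < -c' i := fun k => by
    rw [← mem_coreOf_neg, ← mem_coreOf_neg, h]
  have a1 := h1 (c i).toNat
  have a2 := h1 (c' i).toNat
  have a3 := h2 (-c i).toNat
  have a4 := h2 (-c' i).toNat
  omega

lemma initial_seg {t : ℕ} {S : Finset ℕ} (hS : CoreSet t S) (r : ℕ) (ht : 0 < t) :
    ∃ a : ℕ, ∀ k, r + t * k ∈ S ↔ k < a := by
  classical
  have hex : ∃ k, r + t * k ∉ S := by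
    refine ⟨S.sup id + 1, fun h => ?_⟩
    have h1 := Finset.le_sup (f := id) h
    have h2 : 1 * (S.sup id + 1) ≤ t * (S.sup id + 1) := Nat.mul_le_mul_right _ ht
    simp only [id] at h1 h2
    omega
  refine ⟨Nat.find hex, fun k => ?_⟩
  rw [Nat.lt_find_iff]
  constructor
  · intro h m hm hn
    rcases Nat.lt_or_ge m k with hlt | hge
    · have h3 : t * k = t * m + t * (k - m) := by rw [← Nat.mul_add]; congr 1; omega
      have h4 : 1 * (k - m) ≤ t * (k - m) := Nat.mul_le_mul_right _ ht
      refine (hS _ h).2 _ hn (by omega) ⟨k - m, by omega⟩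
    · have : m = k := by omega
      subst this
      exact hn h
  · intro h; simpa using h k le_rfl

lemma coreOf_surj (n : ℕ) (S : Finset ℕ) (hS : CoreSet (2 * (n + 1)) S) :
    ∃ c, coreOf n c = S := by
  choose a ha using fun i : Fin n => initial_seg hS (i + 1) (by omega)
  choose b hb using fun i : Fin n => initial_seg hS (2 * (n + 1) - (i + 1)) (by omega)
  have hab : ∀ i, a i = 0 ∨ b i = 0 := by
    intro i
    by_contra h
    have h1 := (ha i 0).2 (by omega)
    have h2 := (hb i 0).2 (by omega)
    exact (hS _ h1).1 _ h2 ⟨1, by omega⟩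
  refine ⟨fun i => (a i : ℤ) - b i, ?_⟩
  ext s
  rcases classify n s with ⟨k, rfl⟩ | ⟨k, rfl⟩ | ⟨i, ⟨k, rfl⟩ | ⟨k, rfl⟩⟩
  · simp only [notMem_coreOf_zero, false_iff]
    intro h
    exact (hS _ h).1 _ h ⟨2 * k, by ring⟩
  · simp only [notMem_coreOf_half, false_iff]
    intro h
    exact (hS _ h).1 _ h ⟨1 + 2 * k, by ring⟩
  · rw [mem_coreOf_pos, ha]
    have := hab i
    omega
  · rw [mem_coreOf_neg, hb]
    have := hab i
    omega

/-- integer vectors are core sets -/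
def coreEquiv (n : ℕ) : (Fin n → ℤ) ≃ {S : Finset ℕ // 0 ∉ S ∧ CoreSet (2 * (n + 1)) S} :=
  Equiv.ofBijective (fun c => ⟨coreOf n c, coreOf_core n c⟩)
    ⟨fun c c' h => coreOf_inj n c c' (congrArg Subtype.val h),
     fun S => (coreOf_surj n S.1 S.2.2).imp fun _ h => Subtype.ext h⟩

lemma coreOf_disj (n : ℕ) (c : Fin n → ℤ) :
    Set.PairwiseDisjoint (↑(Finset.univ : Finset (Fin n)))
      (fun i : Fin n => cls (2 * (n + 1)) (i + 1) (c i)) := by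
  intro i _ j _ hij
  rw [Function.onFun, Finset.disjoint_left]
  intro s h1 h2
  rw [mem_cls] at h1 h2
  apply hij
  apply Fin.ext
  rcases h1 with ⟨k, h, rfl⟩ | ⟨k, h, rfl⟩ <;> rcases h2 with ⟨k', h', h3⟩ | ⟨k', h', h3⟩ <;>
    obtain ⟨h4, rfl⟩ := res_uniq (by omega) (by omega) h3 <;> omega

/-- exponent -/
def expo (t r : ℕ) (c : ℤ) : ℕ := ∑ s ∈ cls t r c, s

lemma sum_coreOf (n : ℕ) (c : Fin n → ℤ) :
    ∑ s ∈ coreOf n c, s = ∑ i : Fin n, expo (2 * (n + 1)) (i + 1) (c i) := by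
  rw [coreOf, Finset.sum_biUnion (coreOf_disj n c)]
  rfl

lemma inj_lin {t r : ℕ} (ht : 0 < t) : Function.Injective (fun k => r + t * k) := by
  intro a b h
  have : t * a = t * b := by simp only at h; omega
  exact Nat.eq_of_mul_eq_mul_left ht this

lemma cls_nonneg (t r m : ℕ) :
    cls t r (m : ℤ) = (Finset.range m).image (fun k => r + t * k) := by
  simp [cls]

lemma cls_neg (t r m : ℕ) :
    cls t r (-(m : ℤ)) = (Finset.range m).image (fun k => (t - r) + t * k) := by
  simp [cls]

lemma card_cls {t r : ℕ} (ht : 0 < t) (c : ℤ) : (cls t r c).card = c.natAbs := by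
  obtain ⟨m, rfl | rfl⟩ := Int.eq_nat_or_neg c
  · rw [cls_nonneg, Finset.card_image_of_injective _ (inj_lin ht)]; simp
  · rw [cls_neg, Finset.card_image_of_injective _ (inj_lin ht)]; simp

lemma sum_lin (t r m : ℕ) : ((∑ k ∈ Finset.range m, (r + t * k) : ℕ) : ℤ) * 2 =
    2 * r * m + t * (m * (m - 1)) := by
  induction m with
  | zero => simp
  | succ m ih =>
    rw [Finset.sum_range_succ]; push_cast at ih ⊢
    rw [add_mul, ih]; ring

lemma expo_spec {t r : ℕ} (ht : 0 < t) (hr : r ≤ t) (c : ℤ) :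
    (expo t r c : ℤ) * 2 = 2 * r * c + t * (c * (c - 1)) := by
  unfold expo
  obtain ⟨m, rfl | rfl⟩ := Int.eq_nat_or_neg c
  · rw [cls_nonneg, Finset.sum_image (inj_lin ht).injOn, sum_lin]
  · rw [cls_neg, Finset.sum_image (inj_lin ht).injOn, sum_lin]
    push_cast [hr]; ring

lemma expo_ge {t r : ℕ} (hr0 : 0 < r) (hr : r < t) (c : ℤ) : c.natAbs ≤ expo t r c := by
  rw [← card_cls (t := t) (r := r) (by omega) c, Finset.card_eq_sum_ones, expo]
  apply Finset.sum_le_sum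
  intro s hs
  rw [mem_cls] at hs
  rcases hs with ⟨k, h, rfl⟩ | ⟨k, h, rfl⟩ <;> omega

lemma card_coreOf (n : ℕ) (c : Fin n → ℤ) :
    (coreOf n c).card = ∑ i : Fin n, (c i).natAbs := by
  rw [coreOf, Finset.card_biUnion (coreOf_disj n c)]
  exact Finset.sum_congr rfl fun i _ => card_cls (by omega) _
/-- Gaussian binomial coefficients -/
def gb {R : Type*} [CommRing R] (q : R) : ℕ → ℕ → R
  | _, 0 => 1
  | 0, _ + 1 => 0
  | n + 1, k + 1 => q ^ (k + 1) * gb q n (k + 1) + gb q n k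

lemma gb_zero_right {R : Type*} [CommRing R] (q : R) (n : ℕ) : gb q n 0 = 1 := by
  cases n <;> rfl

lemma gb_succ {R : Type*} [CommRing R] (q : R) (n k : ℕ) :
    gb q (n + 1) (k + 1) = q ^ (k + 1) * gb q n (k + 1) + gb q n k := rfl

lemma gb_eq_zero {R : Type*} [CommRing R] (q : R) (n : ℕ) : ∀ k, n < k → gb q n k = 0 := by
  induction n with
  | zero =>
    intro k hk
    obtain ⟨k, rfl⟩ := Nat.exists_eq_succ_of_ne_zero (by omega : k ≠ 0)
    rfl
  | succ n ih =>
    intro k hk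
    obtain ⟨k, rfl⟩ := Nat.exists_eq_succ_of_ne_zero (by omega : k ≠ 0)
    rw [Nat.succ_eq_add_one, gb_succ, ih _ (by omega), ih _ (by omega)]; simp

lemma gb_prod {R : Type*} [CommRing R] (q A : R) (N : ℕ) : ∀ B : R,
    ∏ j ∈ Finset.range N, (A + B * q ^ j) =
      ∑ k ∈ Finset.range (N + 1), gb q N k * A ^ (N - k) * B ^ k * q ^ (k.choose 2) := by
  induction N with
  | zero => intro B; simp [gb_zero_right]
  | succ N ih =>
    intro B
    rw [Finset.prod_range_succ']
    have h1 : ∏ j ∈ Finset.range N, (A + B * q ^ (j + 1)) =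
        ∏ j ∈ Finset.range N, (A + (B * q) * q ^ j) :=
      Finset.prod_congr rfl fun j _ => by ring
    rw [h1, ih, mul_add]
    have h2 : (∑ k ∈ Finset.range (N + 1), gb q N k * A ^ (N - k) * (B * q) ^ k * q ^ (k.choose 2)) * A
        = ∑ k ∈ Finset.range (N + 2), gb q N k * A ^ (N + 1 - k) * (B * q) ^ k * q ^ (k.choose 2) := by
      rw [Finset.sum_range_succ _ (N + 1), gb_eq_zero q N (N + 1) (by omega), Finset.sum_mul]
      simp only [zero_mul, add_zero]
      apply Finset.sum_congr rfl
      intro k hk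
      rw [Finset.mem_range] at hk
      rw [show N + 1 - k = N - k + 1 by omega]; ring
    rw [h2, Finset.sum_range_succ' _ (N + 1), Finset.sum_range_succ' _ (N + 1), Finset.sum_mul]
    have h3 : ∀ k, gb q (N + 1) (k + 1) * A ^ (N + 1 - (k + 1)) * B ^ (k + 1) * q ^ ((k + 1).choose 2) =
        gb q N (k + 1) * A ^ (N + 1 - (k + 1)) * (B * q) ^ (k + 1) * q ^ ((k + 1).choose 2) +
        gb q N k * A ^ (N - k) * (B * q) ^ k * q ^ k.choose 2 * (B * q ^ 0) := by
      intro k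
      rw [gb_succ, show N + 1 - (k + 1) = N - k by omega,
        show (k + 1).choose 2 = k + k.choose 2 by rw [Nat.choose_succ_succ]; simp]
      ring
    simp only [h3, Finset.sum_add_distrib, gb_zero_right]
    simp
    ring

/-- q-Pochhammer -/
def poch {R : Type*} [CommRing R] (q : R) (n : ℕ) : R := ∏ j ∈ Finset.range n, (1 - q ^ (j + 1))

lemma poch_succ {R : Type*} [CommRing R] (q : R) (n : ℕ) :
    poch q (n + 1) = poch q n * (1 - q ^ (n + 1)) := Finset.prod_range_succ _ _

lemma gb_self {R : Type*} [CommRing R] (q : R) (n : ℕ) : gb q n n = 1 := by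
  induction n with
  | zero => rfl
  | succ n ih => rw [gb_succ, ih, gb_eq_zero _ _ _ (by omega)]; simp

lemma gb_fact {R : Type*} [CommRing R] (q : R) (N : ℕ) : ∀ k l, k + l = N →
    gb q N k * poch q k * poch q l = poch q N := by
  induction N with
  | zero =>
    intro k l h
    obtain rfl : k = 0 := by omega
    obtain rfl : l = 0 := by omega
    simp [gb_zero_right, poch]
  | succ N ih =>
    intro k l h
    rcases Nat.eq_zero_or_pos k with rfl | hk
    · obtain rfl : l = N + 1 := by omega
      simp [gb_zero_right, poch]
    rcases Nat.eq_zero_or_pos l with rfl | hl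
    · obtain rfl : k = N + 1 := by omega
      rw [gb_self]; simp [poch]
    obtain ⟨k, rfl⟩ := Nat.exists_eq_succ_of_ne_zero (by omega : k ≠ 0)
    obtain ⟨l, rfl⟩ := Nat.exists_eq_succ_of_ne_zero (by omega : l ≠ 0)
    simp only [Nat.succ_eq_add_one] at *
    have h1 := ih (k + 1) l (by omega)
    have h2 := ih k (l + 1) (by omega)
    have hN : N = k + l + 1 := by omega
    rw [gb_succ, poch_succ q N]
    calc _ = q ^ (k + 1) * (1 - q ^ (l + 1)) * (gb q N (k + 1) * poch q (k + 1) * poch q l)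
        + (1 - q ^ (k + 1)) * (gb q N k * poch q k * poch q (l + 1)) := by
          rw [poch_succ q k, poch_succ q l]; ring
      _ = _ := by
          rw [h1, h2, hN]; ring

/-- theta term -/
def theta (t r : ℕ) (c : ℤ) : ℤ⟦X⟧ := (-1) ^ c.natAbs * X ^ expo t r c

/-- finite product -/
def jprod (t r m : ℕ) : ℤ⟦X⟧ :=
  ∏ j ∈ Finset.range m, ((1 - X ^ (r + t * j)) * (1 - X ^ ((t - r) + t * j)))

lemma neg_one_natAbs (k m : ℕ) :
    (-1 : ℤ⟦X⟧) ^ k = (-1) ^ m * (-1) ^ ((k : ℤ) - m).natAbs := by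
  rw [← pow_add]
  rcases le_total m k with h | h
  · rw [show m + ((k : ℤ) - m).natAbs = k by omega]
  · obtain ⟨d, rfl⟩ := Nat.exists_eq_add_of_le h
    rw [show k + d + ((k : ℤ) - (k + d : ℕ)).natAbs = k + 2 * d by omega, pow_add, pow_mul]
    simp

lemma jprod_eq {t r : ℕ} (hr : r < t) (m : ℕ) : jprod t r m =
    ∑ k ∈ Finset.range (2 * m + 1), gb (X ^ t : ℤ⟦X⟧) (2 * m) k * theta t r ((k : ℤ) - m) := by
  have h := gb_prod (X ^ t : ℤ⟦X⟧) ((X ^ t) ^ m) (2 * m) (-X ^ r)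
  set E := t * m * m + ∑ j ∈ Finset.range m, (r + t * j) with hE
  have hL : ∏ j ∈ Finset.range (2 * m), ((X ^ t) ^ m + -X ^ r * (X ^ t) ^ j : ℤ⟦X⟧) =
      X ^ E * ((-1) ^ m * jprod t r m) := by
    rw [two_mul, Finset.prod_range_add]
    have a1 : ∏ j ∈ Finset.range m, ((X ^ t) ^ m + -X ^ r * (X ^ t) ^ (m + j) : ℤ⟦X⟧) =
        X ^ (t * m * m) * ∏ j ∈ Finset.range m, (1 - X ^ (r + t * j)) := by
      have hc : (X : ℤ⟦X⟧) ^ (t * m * m) = ∏ _j ∈ Finset.range m, X ^ (t * m) := by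
        rw [Finset.prod_const, Finset.card_range, pow_mul]
      rw [hc, ← Finset.prod_mul_distrib]
      apply Finset.prod_congr rfl
      intro j _
      ring
    have a2 : ∏ j ∈ Finset.range m, ((X ^ t) ^ m + -X ^ r * (X ^ t) ^ j : ℤ⟦X⟧) =
        ((-1) ^ m * X ^ (∑ j ∈ Finset.range m, (r + t * j))) *
          ∏ j ∈ Finset.range m, (1 - X ^ ((t - r) + t * j)) := by
      rw [← Finset.prod_range_reflect (fun j => (1 - X ^ ((t - r) + t * j) : ℤ⟦X⟧)),
        ← Finset.prod_pow_eq_pow_sum]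
      nth_rewrite 3 [← Finset.card_range m]
      rw [← Finset.prod_const, ← Finset.prod_mul_distrib, ← Finset.prod_mul_distrib]
      apply Finset.prod_congr rfl
      intro j hj
      rw [Finset.mem_range] at hj
      have : t * m = (r + t * j) + ((t - r) + t * (m - 1 - j)) := by
        have : t * m = t * j + t + t * (m - 1 - j) := by
          rw [← Nat.mul_succ, ← Nat.mul_add]; congr 1; omega
        omega
      rw [← pow_mul, this, pow_add X (r + t * j) (t - r + _)]
      ring
    rw [a1, a2, hE, jprod, Finset.prod_mul_distrib, pow_add]
    ring
  have hR : ∑ k ∈ Finset.range (2 * m + 1), gb (X ^ t : ℤ⟦X⟧) (2 * m) k * ((X ^ t) ^ m) ^ (2 * m - k)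
      * (-X ^ r) ^ k * (X ^ t) ^ (k.choose 2) = X ^ E * ((-1) ^ m *
        ∑ k ∈ Finset.range (2 * m + 1), gb (X ^ t : ℤ⟦X⟧) (2 * m) k * theta t r ((k : ℤ) - m)) := by
    rw [Finset.mul_sum, Finset.mul_sum]
    apply Finset.sum_congr rfl
    intro k hk
    rw [Finset.mem_range] at hk
    have key : t * m * (2 * m - k) + r * k + t * k.choose 2 = E + expo t r ((k : ℤ) - m) := by
      have e1 := expo_spec (t := t) (r := r) (by omega) hr.le ((k : ℤ) - m)
      have e2 := sum_lin t r m
      have e3 : ((k.choose 2 : ℕ) : ℤ) * 2 = k * (k - 1) := by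
        clear hk e1
        induction k with
        | zero => simp
        | succ k ih =>
          rw [Nat.choose_succ_succ, Nat.choose_one_right]
          push_cast
          rw [add_mul, ih]; ring
      zify [show k ≤ 2 * m by omega]
      rw [hE]
      push_cast at e2 ⊢
      apply mul_left_cancel₀ (two_ne_zero (α := ℤ))
      linear_combination (t : ℤ) * e3 - e2 - e1
    unfold theta
    rw [neg_pow, neg_one_natAbs k m]
    calc _ = gb (X ^ t : ℤ⟦X⟧) (2 * m) k * ((-1) ^ m * (-1) ^ ((k : ℤ) - m).natAbs) *
        X ^ (t * m * (2 * m - k) + r * k + t * k.choose 2) := by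
          rw [pow_add, pow_add, pow_mul X (t * m), pow_mul X t m, pow_mul X r k, pow_mul X t (k.choose 2)]
          ring
      _ = _ := by rw [key, pow_add]; ring
  rw [hL, hR] at h
  have h' := mul_left_cancel₀ (pow_ne_zero _ X_ne_zero) h
  exact mul_left_cancel₀ (pow_ne_zero _ (by simp)) h'

lemma sum_Icc_shift {M : Type*} [AddCommMonoid M] (m : ℕ) (g : ℤ → M) :
    ∑ c ∈ Finset.Icc (-(m : ℤ)) m, g c = ∑ k ∈ Finset.range (2 * m + 1), g ((k : ℤ) - m) := by
  symm
  refine Finset.sum_bij' (fun k _ => (k : ℤ) - m) (fun c _ => (c + m).toNat) ?_ ?_ ?_ ?_ ?_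
  · intro k hk; simp only [Finset.mem_range, Finset.mem_Icc] at *; omega
  · intro k hk; simp only [Finset.mem_range, Finset.mem_Icc] at *; omega
  · intro k hk; simp only [Finset.mem_range, Finset.mem_Icc] at *; omega
  · intro k hk; simp only [Finset.mem_range, Finset.mem_Icc] at *; omega
  · intro k hk; rfl

lemma jacobi_mod {t r : ℕ} (hr0 : 0 < r) (hr : r < t) (Q : ℤ⟦X⟧) (hu : IsUnit Q)
    (hQ : ∀ d, ∃ M, ∀ n ≥ M, X ^ d ∣ poch (X ^ t : ℤ⟦X⟧) n - Q) (d : ℕ) :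
    ∃ M, ∀ m ≥ M, X ^ d ∣ Q * jprod t r m - ∑ c ∈ Finset.Icc (-(m : ℤ)) m, theta t r c := by
  obtain ⟨M, hM⟩ := hQ d
  refine ⟨M + d, fun m hm => ?_⟩
  rw [sum_Icc_shift, jprod_eq hr, Finset.mul_sum, ← Finset.sum_sub_distrib]
  apply Finset.dvd_sum
  intro k hk
  rw [Finset.mem_range] at hk
  by_cases hd : d ≤ expo t r ((k : ℤ) - m)
  · have : (X : ℤ⟦X⟧) ^ d ∣ theta t r ((k : ℤ) - m) := Dvd.dvd.mul_left (pow_dvd_pow _ hd) _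
    exact dvd_sub ((this.mul_left _).mul_left _) this
  · have hge := expo_ge hr0 hr ((k : ℤ) - m)
    have hf := gb_fact (X ^ t : ℤ⟦X⟧) (2 * m) k (2 * m - k) (by omega)
    obtain ⟨a, ha⟩ := hM k (by omega)
    obtain ⟨b, hb⟩ := hM (2 * m - k) (by omega)
    obtain ⟨c, hc⟩ := hM (2 * m) (by omega)
    have h1 : X ^ d ∣ Q * gb (X ^ t : ℤ⟦X⟧) (2 * m) k - 1 := by
      rw [← hu.dvd_mul_left (a := (X : ℤ⟦X⟧) ^ d) (b := Q * gb (X ^ t : ℤ⟦X⟧) (2 * m) k - 1)]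
      have e1 : poch (X ^ t : ℤ⟦X⟧) k = Q + X ^ d * a := by rw [← ha]; ring
      have e2 : poch (X ^ t : ℤ⟦X⟧) (2 * m - k) = Q + X ^ d * b := by rw [← hb]; ring
      have e3 : poch (X ^ t : ℤ⟦X⟧) (2 * m) = Q + X ^ d * c := by rw [← hc]; ring
      rw [e1, e2, e3] at hf
      refine ⟨c - gb (X ^ t : ℤ⟦X⟧) (2 * m) k * (a * Q + b * Q + X ^ d * a * b), ?_⟩
      linear_combination hf
    have := h1.mul_right (theta t r ((k : ℤ) - m))
    convert this using 1
    ring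
instance instT2PS : T2Space (ℤ⟦X⟧) := PowerSeries.WithPiTopology.instT2Space (R := ℤ)

instance instTRPS : IsTopologicalRing (ℤ⟦X⟧) := PowerSeries.WithPiTopology.instIsTopologicalRing (R := ℤ)

lemma tendsto_iff_dvd (f : ℕ → ℤ⟦X⟧) (a : ℤ⟦X⟧) : Filter.Tendsto f Filter.atTop (nhds a) ↔
    ∀ d, ∃ M, ∀ n ≥ M, X ^ d ∣ f n - a := by
  have h0 : Filter.Tendsto f Filter.atTop (nhds a) ↔
    ∀ d, Filter.Tendsto (fun n => coeff d (f n)) Filter.atTop (nhds (coeff d a)) :=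
    PowerSeries.WithPiTopology.tendsto_iff_coeff_tendsto (R := ℤ) f Filter.atTop a
  rw [h0]
  simp only [nhds_discrete, Filter.tendsto_pure, Filter.eventually_atTop]
  constructor
  · intro h d
    choose M hM using h
    refine ⟨(Finset.range d).sup M, fun n hn => ?_⟩
    rw [X_pow_dvd_iff]
    intro m hm
    rw [map_sub, hM m n ((Finset.le_sup (Finset.mem_range.2 hm)).trans hn), sub_self]
  · intro h d
    obtain ⟨M, hM⟩ := h (d + 1)
    refine ⟨M, fun n hn => ?_⟩
    have := X_pow_dvd_iff.1 (hM n hn) d (by omega)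
    rw [map_sub] at this
    linarith

lemma multipliable_of_dvd (f : ℕ → ℤ⟦X⟧) (h : ∀ k, X ^ (k + 1) ∣ f k - 1) : Multipliable f := by
  have h1 : Filter.Tendsto (fun k => (f k - 1).order) Filter.atTop (nhds ⊤) := by
    refine ENat.tendsto_nhds_top_iff_natCast_lt.mpr (fun n ↦ Filter.eventually_atTop.mpr ⟨n, ?_⟩)
    intro m hm
    have : ((m + 1 : ℕ) : ℕ∞) ≤ (f m - 1).order :=
      nat_le_order _ _ fun i hi => X_pow_dvd_iff.1 (h m) i hi
    refine lt_of_lt_of_le ?_ this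
    norm_cast
    omega
  have h2 : Multipliable (fun k => 1 + (f k - 1)) :=
    PowerSeries.WithPiTopology.multipliable_one_add_of_tendsto_order_atTop_nhds_top (R := ℤ) h1
  simpa using h2

lemma mult_X (a : ℕ) (ha : 0 < a) : Multipliable (fun k : ℕ => (1 - X ^ ((k + 1) * a) : ℤ⟦X⟧)) := by
  apply multipliable_of_dvd
  intro k
  rw [show (1 - X ^ ((k + 1) * a) - 1 : ℤ⟦X⟧) = - X ^ ((k + 1) * a) by ring, dvd_neg]
  exact pow_dvd_pow _ (Nat.le_mul_of_pos_right _ ha)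

lemma summable_theta (n : ℕ) :
    Summable (fun c : Fin n → ℤ => ∏ i : Fin n, theta (2 * (n + 1)) (i + 1) (c i)) := by
  apply (PowerSeries.WithPiTopology.summable_iff_summable_coeff (R := ℤ)).2
  intro d
  apply summable_of_hasFiniteSupport
  apply (Finset.finite_toSet (Fintype.piFinset fun _ : Fin n => Finset.Icc (-(d : ℤ)) d)).subset
  intro c hc
  rw [Function.mem_support] at hc
  simp only [theta, Finset.prod_mul_distrib, Finset.prod_pow_eq_pow_sum] at hc
  have hd : ∑ i : Fin n, expo (2 * (n + 1)) (i + 1) (c i) ≤ d := by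
    by_contra h
    apply hc
    exact X_pow_dvd_iff.1 (Dvd.intro_left _ rfl) d (by omega)
  simp only [Finset.mem_coe, Fintype.mem_piFinset, Finset.mem_Icc]
  intro i
  have h1 := Finset.single_le_sum (f := fun i : Fin n => expo (2 * (n + 1)) (i + 1) (c i))
    (fun _ _ => Nat.zero_le _) (Finset.mem_univ i)
  have h2 := expo_ge (t := 2 * (n + 1)) (r := i + 1) (by omega) (by omega) (c i)
  beta_reduce at h1
  omega

lemma tendsto_boxes (n : ℕ) : Filter.Tendsto
    (fun m : ℕ => Fintype.piFinset fun _ : Fin n => Finset.Icc (-(m : ℤ)) m)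
    Filter.atTop Filter.atTop := by
  apply Filter.tendsto_atTop_finset_of_monotone
  · intro a b hab
    apply Fintype.piFinset_subset
    intro i
    apply Finset.Icc_subset_Icc <;> omega
  · intro c
    refine ⟨∑ i, (c i).natAbs, ?_⟩
    simp only [Fintype.mem_piFinset, Finset.mem_Icc]
    intro i
    have h1 := Finset.single_le_sum (f := fun i : Fin n => (c i).natAbs)
      (fun _ _ => Nat.zero_le _) (Finset.mem_univ i)
    beta_reduce at h1
    omega

lemma dvd_prod_sub {ι : Type*} (s : Finset ι) (a : ℤ⟦X⟧) (f g : ι → ℤ⟦X⟧)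
    (h : ∀ i ∈ s, a ∣ f i - g i) : a ∣ ∏ i ∈ s, f i - ∏ i ∈ s, g i := by
  classical
  induction s using Finset.induction_on with
  | empty => simp
  | insert i s hi ih =>
    rw [Finset.prod_insert hi, Finset.prod_insert hi]
    have h1 := h i (Finset.mem_insert_self _ _)
    have h2 := ih fun j hj => h j (Finset.mem_insert_of_mem hj)
    have : f i * ∏ i ∈ s, f i - g i * ∏ i ∈ s, g i =
      (f i - g i) * ∏ i ∈ s, f i + g i * (∏ i ∈ s, f i - ∏ i ∈ s, g i) := by ring
    rw [this]
    exact dvd_add (h1.mul_right _) (h2.mul_left _)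

/-- pairing up `1, …, 2n+1` -/
lemma prod_pair (n : ℕ) (y : ℕ → ℤ⟦X⟧) :
    (∏ i : Fin n, (y (i + 1) * y (2 * (n + 1) - (i + 1)))) * (y (n + 1) * y (2 * (n + 1))) =
      ∏ k ∈ Finset.range (2 * (n + 1)), y (k + 1) := by
  rw [Fin.prod_univ_eq_prod_range (fun i => y (i + 1) * y (2 * (n + 1) - (i + 1))) n,
    Finset.prod_mul_distrib]
  rw [show 2 * (n + 1) = (n + 1 + n) + 1 by ring, Finset.prod_range_succ _ (n + 1 + n),
    Finset.prod_range_add, Finset.prod_range_succ _ n]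
  rw [← Finset.prod_range_reflect (fun j => y (n + 1 + j + 1))]
  have : ∏ x ∈ Finset.range n, y (n + 1 + n + 1 - (x + 1)) =
      ∏ j ∈ Finset.range n, y (n + 1 + (n - 1 - j) + 1) := by
    apply Finset.prod_congr rfl
    intro j hj
    rw [Finset.mem_range] at hj
    congr 1
    omega
  rw [this]
  ring

lemma finite_identity (n m : ℕ) :
    (∏ i : Fin n, jprod (2 * (n + 1)) (i + 1) m) *
      ∏ k ∈ Finset.range (2 * m), (1 - X ^ ((k + 1) * (n + 1)) : ℤ⟦X⟧) =
    ∏ k ∈ Finset.range (m * (2 * (n + 1))), (1 - X ^ ((k + 1) * 1)) := by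
  induction m with
  | zero => simp [jprod]
  | succ m ih =>
    have h1 : ∀ i : Fin n, jprod (2 * (n + 1)) (i + 1) (m + 1) = jprod (2 * (n + 1)) (i + 1) m *
      ((1 - X ^ ((i + 1) + 2 * (n + 1) * m)) *
        (1 - X ^ ((2 * (n + 1) - (i + 1)) + 2 * (n + 1) * m))) := fun i =>
      Finset.prod_range_succ _ _
    simp only [h1]
    rw [Finset.prod_mul_distrib, show 2 * (m + 1) = 2 * m + 1 + 1 by ring,
      Finset.prod_range_succ, Finset.prod_range_succ,
      show (m + 1) * (2 * (n + 1)) = m * (2 * (n + 1)) + 2 * (n + 1) by ring,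
      Finset.prod_range_add, ← ih]
    have h2 := prod_pair n (fun s => 1 - X ^ (s + 2 * (n + 1) * m))
    have h3 : ∏ x ∈ Finset.range (2 * (n + 1)), (1 - X ^ ((m * (2 * (n + 1)) + x + 1) * 1) : ℤ⟦X⟧) =
        ∏ k ∈ Finset.range (2 * (n + 1)), (1 - X ^ (k + 1 + 2 * (n + 1) * m)) := by
      apply Finset.prod_congr rfl
      intro k _
      congr 2
      ring
    rw [h3, ← h2]
    rw [show (2 * m + 1) * (n + 1) = n + 1 + 2 * (n + 1) * m by ring,
      show (2 * m + 1 + 1) * (n + 1) = 2 * (n + 1) + 2 * (n + 1) * m by ring]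
    ring

lemma core_limit (n : ℕ) :
    (∑' c : Fin n → ℤ, ∏ i : Fin n, theta (2 * (n + 1)) (i + 1) (c i)) *
      ∏' k : ℕ, (1 - X ^ ((k + 1) * (n + 1)) : ℤ⟦X⟧) =
    (∏' k : ℕ, (1 - X ^ ((k + 1) * (2 * (n + 1))) : ℤ⟦X⟧)) ^ n *
      ∏' k : ℕ, (1 - X ^ ((k + 1) * 1) : ℤ⟦X⟧) := by
  set L := ∑' c : Fin n → ℤ, ∏ i : Fin n, theta (2 * (n + 1)) (i + 1) (c i) with hL
  set Q := ∏' k : ℕ, (1 - X ^ ((k + 1) * (2 * (n + 1))) : ℤ⟦X⟧) with hQd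
  have hQ0 : Filter.Tendsto (fun m => poch (X ^ (2 * (n + 1)) : ℤ⟦X⟧) m) Filter.atTop (nhds Q) := by
    have := (mult_X (2 * (n + 1)) (by omega)).hasProd.tendsto_prod_nat
    refine this.congr fun m => ?_
    rw [poch]
    apply Finset.prod_congr rfl
    intro k _
    rw [← pow_mul]
    congr 2
    ring
  have hQ := (tendsto_iff_dvd _ _).1 hQ0
  have hu : IsUnit Q := by
    rw [isUnit_iff_constantCoeff]
    obtain ⟨M, hM⟩ := hQ 1
    have h1 := X_pow_dvd_iff.1 (hM M le_rfl) 0 (by omega)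
    rw [map_sub, coeff_zero_eq_constantCoeff_apply, coeff_zero_eq_constantCoeff_apply] at h1
    have h2 : constantCoeff (poch (X ^ (2 * (n + 1)) : ℤ⟦X⟧) M) = 1 := by
      rw [poch, map_prod]
      apply Finset.prod_eq_one
      intro k _
      simp
    have : constantCoeff Q = 1 := by linarith
    rw [this]; exact isUnit_one
  have hT : Filter.Tendsto (fun m : ℕ => ∏ i : Fin n, ∑ c ∈ Finset.Icc (-(m : ℤ)) m,
      theta (2 * (n + 1)) (i + 1) c) Filter.atTop (nhds L) := by
    have := (summable_theta n).hasSum.comp (tendsto_boxes n)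
    refine this.congr fun m => ?_
    simp only [Function.comp]
    rw [Finset.prod_univ_sum]
  have hP : Filter.Tendsto (fun m : ℕ => ∏ i : Fin n, (Q * jprod (2 * (n + 1)) (i + 1) m))
      Filter.atTop (nhds L) := by
    rw [tendsto_iff_dvd] at hT ⊢
    intro d
    obtain ⟨M1, h1⟩ := hT d
    choose M2 h2 using fun i : Fin n => jacobi_mod (t := 2 * (n + 1)) (r := i + 1) (by omega)
      (by omega) Q hu hQ d
    refine ⟨M1 + ∑ i, M2 i, fun m hm => ?_⟩
    have h3 := dvd_prod_sub Finset.univ (X ^ d) (fun i : Fin n => Q * jprod (2 * (n + 1)) (i + 1) m)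
      (fun i => ∑ c ∈ Finset.Icc (-(m : ℤ)) m, theta (2 * (n + 1)) (i + 1) c) (by
        intro i _
        apply h2
        have := Finset.single_le_sum (f := M2) (fun _ _ => Nat.zero_le _) (Finset.mem_univ i)
        omega)
    have h4 := dvd_add h3 (h1 m (by omega))
    convert h4 using 1
    ring
  have hW := (mult_X (n + 1) (by omega)).hasProd.tendsto_prod_nat
  have hE := (mult_X 1 (by omega)).hasProd.tendsto_prod_nat
  have hW2 := hW.comp (Filter.tendsto_id.const_mul_atTop' (show 0 < 2 by norm_num))
  have hE2 := hE.comp (Filter.tendsto_id.atTop_mul_const' (show 0 < 2 * (n + 1) by omega))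
  have e1 := hP.mul hW2
  have e2 := hE2.const_mul (Q ^ n)
  refine tendsto_nhds_unique (e1.congr fun m => ?_) e2
  simp only [Function.comp, id]
  rw [Finset.prod_mul_distrib, Finset.prod_const, Finset.card_univ, Fintype.card_fin, mul_assoc,
    finite_identity]
theorem signed_genfun_DD_cores_even (t' : ℕ) (ht' : 0 < t') :
    ∑' μ : {μ : YoungDiagram // DDiagram μ ∧
        ∀ c ∈ μ.cells, ¬ (2 * t') ∣ hookLen μ c},
      PowerSeries.C (R := ℤ) ((-1) ^ durfee μ.1) * X ^ (μ.1.card / 2)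
      =
    ∏' k : ℕ,
      ((1 - X ^ (k + 1)) * (1 - X ^ ((k + 1) * (2 * t'))) ^ (t' - 1) *
        PowerSeries.invOfUnit (1 - X ^ ((k + 1) * t')) 1) := by
  obtain ⟨n, rfl⟩ := Nat.exists_eq_succ_of_ne_zero (by omega : t' ≠ 0)
  simp only [Nat.succ_eq_add_one, Nat.add_sub_cancel]
  have hlim := core_limit n
  have hL : (∑' μ : {μ : YoungDiagram // DDiagram μ ∧
        ∀ c ∈ μ.cells, ¬ (2 * (n + 1)) ∣ hookLen μ c},
      PowerSeries.C (R := ℤ) ((-1) ^ durfee μ.1) * X ^ (μ.1.card / 2)) =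
      ∑' c : Fin n → ℤ, ∏ i : Fin n, theta (2 * (n + 1)) (i + 1) (c i) := by
    rw [← ((coreEquiv n).trans (ddEquiv (2 * (n + 1))).symm).tsum_eq]
    congr 1
    funext c
    set μ := ((coreEquiv n).trans (ddEquiv (2 * (n + 1))).symm) c with hμ
    have h1 : arms μ.1 = coreOf n c := by
      have : ddEquiv (2 * (n + 1)) μ = coreEquiv n c := by rw [hμ]; simp
      exact congrArg Subtype.val this
    have h2 : durfee μ.1 = ∑ i : Fin n, (c i).natAbs := by
      rw [← card_arms, h1, card_coreOf]
    have h3 : μ.1.card / 2 = ∑ i : Fin n, expo (2 * (n + 1)) (i + 1) (c i) := by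
      rw [card_dd μ.2.1, h1, sum_coreOf]; omega
    rw [h2, h3]
    simp only [theta, Finset.prod_mul_distrib, Finset.prod_pow_eq_pow_sum]
    simp
  have hinv : ∀ k : ℕ, (1 - X ^ ((k + 1) * (n + 1)) : ℤ⟦X⟧) *
      PowerSeries.invOfUnit (1 - X ^ ((k + 1) * (n + 1))) 1 = 1 := fun k =>
    PowerSeries.mul_invOfUnit _ _ (by simp)
  have hm1 := mult_X 1 (by omega)
  have hm2 := mult_X (2 * (n + 1)) (by omega)
  have hm3 := mult_X (n + 1) (by omega)
  have hm4 : Multipliable fun k : ℕ =>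
      PowerSeries.invOfUnit (1 - X ^ ((k + 1) * (n + 1)) : ℤ⟦X⟧) 1 := by
    apply multipliable_of_dvd
    intro k
    have h1 : PowerSeries.invOfUnit (1 - X ^ ((k + 1) * (n + 1)) : ℤ⟦X⟧) 1 - 1 =
        X ^ ((k + 1) * (n + 1)) * PowerSeries.invOfUnit (1 - X ^ ((k + 1) * (n + 1)) : ℤ⟦X⟧) 1 := by
      linear_combination hinv k
    rw [h1]
    exact (pow_dvd_pow _ (Nat.le_mul_of_pos_right _ (by omega))).mul_right _
  have hWV : (∏' k : ℕ, (1 - X ^ ((k + 1) * (n + 1)) : ℤ⟦X⟧)) *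
      ∏' k : ℕ, PowerSeries.invOfUnit (1 - X ^ ((k + 1) * (n + 1)) : ℤ⟦X⟧) 1 = 1 := by
    rw [← hm3.tprod_mul hm4]
    simp only [hinv, tprod_one]
  have hm2n : Multipliable fun k : ℕ => (1 - X ^ ((k + 1) * (2 * (n + 1))) : ℤ⟦X⟧) ^ n :=
    hm2.pow n
  have hR : (∏' k : ℕ,
      ((1 - X ^ (k + 1)) * (1 - X ^ ((k + 1) * (2 * (n + 1)))) ^ n *
        PowerSeries.invOfUnit (1 - X ^ ((k + 1) * (n + 1)) : ℤ⟦X⟧) 1)) =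
      (∏' k : ℕ, (1 - X ^ ((k + 1) * 1) : ℤ⟦X⟧)) *
      (∏' k : ℕ, (1 - X ^ ((k + 1) * (2 * (n + 1))) : ℤ⟦X⟧)) ^ n *
      ∏' k : ℕ, PowerSeries.invOfUnit (1 - X ^ ((k + 1) * (n + 1)) : ℤ⟦X⟧) 1 := by
    rw [← hm2.tprod_pow n, ← hm1.tprod_mul hm2n, ← (hm1.mul hm2n).tprod_mul hm4]
    simp only [mul_one]
  rw [hL, hR]
  linear_combination
    (∏' k : ℕ, PowerSeries.invOfUnit (1 - X ^ ((k + 1) * (n + 1)) : ℤ⟦X⟧) 1) * hlim -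
    (∑' c : Fin n → ℤ, ∏ i : Fin n, theta (2 * (n + 1)) (i + 1) (c i)) * hWV
end
end
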